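/- Let Ω ⊆ ℝ³ be open and let f = f₀ + f₁e₁ + f₂e₂ and g = g₀ + g₁e₁ + g₂e₂ be C¹ reduced-quaternion-valued functions on Ω. Then the following Leibniz rules hold for the right Cauchy–Riemann operators: (fg)∂̄ = f(g∂̄) + (f∂̄)g + 2(g₁(∂₂f) − g₂(∂₁f))e₃ and (fg)∂ = f(g∂) + (f∂)g − 2(g₁(∂₂f) − g₂(∂₁f))e₃, where the quaternion product fg is taken pointwise. -/

import Mathlib

open Quaternion

noncomputable section

abbrev R3 := Fin 3 → ℝ

/-- Partial derivative `∂ᵢ` in the coordinate direction `i`. -/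
noncomputable def pd {E : Type*} [NormedAddCommGroup E] [NormedSpace ℝ E]
    (i : Fin 3) (f : R3 → E) (x : R3) : E :=
  fderiv ℝ f x (Pi.single i 1)

/-- The quaternion unit `e₁`. -/
def e1 : ℍ[ℝ] := ⟨0,1,0,0⟩
/-- The quaternion unit `e₂`. -/
def e2 : ℍ[ℝ] := ⟨0,0,1,0⟩
/-- The quaternion unit `e₃`. -/
def e3 : ℍ[ℝ] := ⟨0,0,0,1⟩

/-- The units `e₀ = 1, e₁, e₂`. -/
def eu : Fin 3 → ℍ[ℝ] := ![1, e1, e2]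
/-- The signs `ε₀ = 1, ε₁ = ε₂ = −1`. -/
def eps : Fin 3 → ℝ := ![1, -1, -1]

/-- The two-sided operator `∂̄f∂̄ = Σᵢⱼ eᵢ(∂ᵢ∂ⱼf)eⱼ`. -/
noncomputable def sandwichBar (f : R3 → ℍ[ℝ]) (x : R3) : ℍ[ℝ] :=
  ∑ i : Fin 3, ∑ j : Fin 3, eu i * pd i (pd j f) x * eu j

/-- The two-sided operator `∂f∂ = Σᵢⱼ εᵢεⱼ eᵢ(∂ᵢ∂ⱼf)eⱼ`. -/
noncomputable def sandwich (f : R3 → ℍ[ℝ]) (x : R3) : ℍ[ℝ] :=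
  ∑ i : Fin 3, ∑ j : Fin 3, (eps i * eps j) • (eu i * pd i (pd j f) x * eu j)

/-- The Laplacian `Δ = ∂₀² + ∂₁² + ∂₂²`. -/
noncomputable def lap {E : Type*} [NormedAddCommGroup E] [NormedSpace ℝ E]
    (f : R3 → E) (x : R3) : E :=
  pd 0 (pd 0 f) x + pd 1 (pd 1 f) x + pd 2 (pd 2 f) x

/-- The left Cauchy–Riemann operator `∂̄f = ∂₀f + e₁(∂₁f) + e₂(∂₂f)`. -/
noncomputable def DbarL (f : R3 → ℍ[ℝ]) (x : R3) : ℍ[ℝ] :=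
  pd 0 f x + e1 * pd 1 f x + e2 * pd 2 f x

/-- The left conjugate Cauchy–Riemann operator `∂f = ∂₀f − e₁(∂₁f) − e₂(∂₂f)`. -/
noncomputable def DL (f : R3 → ℍ[ℝ]) (x : R3) : ℍ[ℝ] :=
  pd 0 f x - e1 * pd 1 f x - e2 * pd 2 f x

/-- The right Cauchy–Riemann operator `f∂̄ = ∂₀f + (∂₁f)e₁ + (∂₂f)e₂`. -/
noncomputable def DbarR (f : R3 → ℍ[ℝ]) (x : R3) : ℍ[ℝ] :=
  pd 0 f x + pd 1 f x * e1 + pd 2 f x * e2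

/-- The right conjugate Cauchy–Riemann operator `f∂ = ∂₀f − (∂₁f)e₁ − (∂₂f)e₂`. -/
noncomputable def DR (f : R3 → ℍ[ℝ]) (x : R3) : ℍ[ℝ] :=
  pd 0 f x - pd 1 f x * e1 - pd 2 f x * e2

/-- The product rule for partial derivatives of quaternion-valued functions. -/
theorem pd_mul (i : Fin 3) {f g : R3 → ℍ[ℝ]} {x : R3}
    (hf : DifferentiableAt ℝ f x) (hg : DifferentiableAt ℝ g x) :
    pd i (fun y => f y * g y) x = f x * pd i g x + pd i f x * g x := by
  simp [pd, fderiv_fun_mul' hf hg]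

@[simp] theorem e1_re : e1.re = 0 := rfl
@[simp] theorem e1_imI : e1.imI = 1 := rfl
@[simp] theorem e1_imJ : e1.imJ = 0 := rfl
@[simp] theorem e1_imK : e1.imK = 0 := rfl

@[simp] theorem e2_re : e2.re = 0 := rfl
@[simp] theorem e2_imI : e2.imI = 0 := rfl
@[simp] theorem e2_imJ : e2.imJ = 1 := rfl
@[simp] theorem e2_imK : e2.imK = 0 := rfl

@[simp] theorem e3_re : e3.re = 0 := rfl
@[simp] theorem e3_imI : e3.imI = 0 := rfl
@[simp] theorem e3_imJ : e3.imJ = 0 := rfl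
@[simp] theorem e3_imK : e3.imK = 1 := rfl

theorem mul_e1_of_imK_eq_zero {q : ℍ[ℝ]} (hq : q.imK = 0) :
    q * e1 = e1 * q - (2 * q.imJ) • e3 := by
  ext <;> simp [hq]
  ring

theorem mul_e2_of_imK_eq_zero {q : ℍ[ℝ]} (hq : q.imK = 0) :
    q * e2 = e2 * q + (2 * q.imI) • e3 := by
  ext <;> simp [hq]
  ring

/-- Leibniz rules for the right Cauchy–Riemann operators applied to a
pointwise product of C¹ reduced-quaternion-valued functions:
`(fg)∂̄ = f(g∂̄) + (f∂̄)g + 2(g₁(∂₂f) − g₂(∂₁f))e₃` and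
`(fg)∂ = f(g∂) + (f∂)g − 2(g₁(∂₂f) − g₂(∂₁f))e₃`. -/
theorem stmt10 (Ω : Set R3) (hΩ : IsOpen Ω) (f g : R3 → ℍ[ℝ])
    (hf : ContDiffOn ℝ 1 f Ω) (hg : ContDiffOn ℝ 1 g Ω)
    (hfred : ∀ x ∈ Ω, (f x).imK = 0) (hgred : ∀ x ∈ Ω, (g x).imK = 0) :
    ∀ x ∈ Ω,
      DbarR (fun y => f y * g y) x
        = f x * DbarR g x + DbarR f x * g x
          + 2 * (((g x).imI • pd 2 f x - (g x).imJ • pd 1 f x) * e3) ∧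
      DR (fun y => f y * g y) x
        = f x * DR g x + DR f x * g x
          - 2 * (((g x).imI • pd 2 f x - (g x).imJ • pd 1 f x) * e3) := by
  intro x hx
  have hf' := (hf.contDiffAt (hΩ.mem_nhds hx)).differentiableAt one_ne_zero
  have hg' := (hg.contDiffAt (hΩ.mem_nhds hx)).differentiableAt one_ne_zero
  have h1 := mul_e1_of_imK_eq_zero (hgred x hx)
  have h2 := mul_e2_of_imK_eq_zero (hgred x hx)
  simp only [DbarR, DR, pd_mul _ hf' hg', add_mul, sub_mul, mul_add, mul_sub, mul_assoc, h1, h2,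
    smul_mul_assoc, mul_smul_comm, two_mul]
  constructor <;> module
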